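/- Every definable (in the field language) subgroup of (K^×)^n for K an algebraically closed field is defined by a finite set of equations of the form x_1^{k_1}⋯x_n^{k_n} = 1 with (k_1,…,k_n) ∈ ℤ^n. -/

import Mathlib

open FirstOrder Topology MvPolynomial

section Topology

variable {X Y : Type*} [TopologicalSpace X] [TopologicalSpace Y]

theorem interior_frontier_union_eq_empty {s t : Set X} (hs : interior (frontier s) = ∅)
    (ht : interior (frontier t) = ∅) : interior (frontier (s ∪ t)) = ∅ := by
  have hsub : frontier (s ∪ t) ⊆ frontier s ∪ frontier t :=
    (frontier_union_subset s t).trans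
      (Set.union_subset_union Set.inter_subset_left Set.inter_subset_right)
  refine Set.subset_eq_empty (interior_mono hsub) ?_
  rw [interior_union_isClosed_of_interior_empty isClosed_frontier ht, hs]

theorem Topology.IsConstructible.interior_frontier_preimage {f : X → Y} (hf : Continuous f)
    {s : Set Y} (hs : IsConstructible s) : interior (frontier (f ⁻¹' s)) = ∅ := by
  induction hs using IsConstructible.empty_union_induction with
  | open_retrocompact U hU _ =>
    rw [← frontier_compl]
    exact interior_frontier (hU.preimage hf).isClosed_compl
  | union s _ t _ hs ht => exact interior_frontier_union_eq_empty hs ht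
  | compl s _ hs => rwa [Set.preimage_compl, frontier_compl]

theorem Subgroup.eq_top_of_dense_of_interior_frontier_eq_empty {H : Type*} [Group H]
    [TopologicalSpace H] (hmul : ∀ h : H, Continuous (h * ·)) {G : Subgroup H}
    (hd : Dense (G : Set H)) (hG : interior (frontier (G : Set H)) = ∅) : G = ⊤ := by
  obtain ⟨u, hu⟩ : (interior (G : Set H)).Nonempty := by
    rw [Set.nonempty_iff_ne_empty]
    intro h
    rw [frontier, hd.closure_eq, h, Set.sdiff_empty, interior_univ] at hG
    exact Set.univ_nonempty.ne_empty hG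
  refine eq_top_iff.2 fun h _ => ?_
  obtain ⟨x, hx, hxG⟩ := hd.inter_open_nonempty _
    (isOpen_interior.preimage (hmul (u * h⁻¹))) ⟨h, by simpa using hu⟩
  have h1 : u * h⁻¹ * x ∈ G := interior_subset (s := (G : Set H)) hx
  have h2 : u * h⁻¹ ∈ G := (G.mul_mem_cancel_right hxG).1 h1
  exact G.inv_mem_iff.1 ((G.mul_mem_cancel_left (interior_subset hu)).1 h2)

end Topology

theorem PrimeSpectrum.exists_le_isMaximal_mem_of_isConstructible {R : Type*} [CommRing R]
    [IsJacobsonRing R] {C : Set (PrimeSpectrum R)} (hC : IsConstructible C)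
    {P : PrimeSpectrum R} (hP : P ∈ C) : ∃ Q ∈ C, P ≤ Q ∧ Q.asIdeal.IsMaximal := by
  obtain ⟨S, rfl⟩ := exists_constructibleSetData_iff.2 hC
  simp only [ConstructibleSetData.toSet, Set.mem_iUnion] at hP
  obtain ⟨B, hBS, hPB⟩ := hP
  have hlc : IsLocallyClosed (B.toSet ∩ closure {P}) :=
    ((isClosed_zeroLocus _).isLocallyClosed.inter
      (isClosed_zeroLocus _).isOpen_compl.isLocallyClosed).inter isClosed_closure.isLocallyClosed
  obtain ⟨Q, ⟨hQB, hQP⟩, hQ⟩ :=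
    nonempty_inter_closedPoints (Z := B.toSet ∩ closure {P}) ⟨P, hPB, subset_closure rfl⟩ hlc
  refine ⟨Q, Set.mem_biUnion hBS hQB, ?_, ?_⟩
  · rwa [le_iff_mem_closure]
  · rwa [mem_closedPoints_iff, isClosed_singleton_iff_isMaximal] at hQ

section Constructible

variable {K : Type*} [Field K] {σ τ : Type*}

/-- A set of points of affine space is constructible if it is the set of rational points of a
constructible subset of the spectrum of the polynomial ring. -/
def IsConstructiblePointSet (s : Set (σ → K)) : Prop :=
  ∃ C : Set (PrimeSpectrum (MvPolynomial σ K)),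
    IsConstructible C ∧ (pointToPoint (k := K) : (σ → K) → _) ⁻¹' C = s

theorem mem_asIdeal_pointToPoint {x : σ → K} {p : MvPolynomial σ K} :
    p ∈ (pointToPoint (k := K) x).asIdeal ↔ aeval x p = 0 :=
  mem_vanishingIdeal_singleton_iff x p

theorem comap_pointToPoint (f : MvPolynomial σ K →ₐ[K] MvPolynomial τ K) (x : τ → K) :
    PrimeSpectrum.comap f.toRingHom (pointToPoint (k := K) x) =
      pointToPoint (k := K) fun i => aeval x (f (X i)) := by
  ext p
  have h : (aeval x).comp f = aeval fun i => aeval x (f (X i)) := by ext; simp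
  rw [PrimeSpectrum.comap_asIdeal, Ideal.mem_comap, mem_asIdeal_pointToPoint,
    mem_asIdeal_pointToPoint, ← h]
  rfl

namespace IsConstructiblePointSet

theorem compl {s : Set (σ → K)} (hs : IsConstructiblePointSet s) :
    IsConstructiblePointSet sᶜ := by
  obtain ⟨C, hC, rfl⟩ := hs
  exact ⟨Cᶜ, hC.compl, rfl⟩

theorem union {s t : Set (σ → K)} (hs : IsConstructiblePointSet s)
    (ht : IsConstructiblePointSet t) : IsConstructiblePointSet (s ∪ t) := by
  obtain ⟨C, hC, rfl⟩ := hs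
  obtain ⟨D, hD, rfl⟩ := ht
  exact ⟨C ∪ D, hC.union hD, rfl⟩

protected theorem empty : IsConstructiblePointSet (∅ : Set (σ → K)) :=
  ⟨∅, .empty, rfl⟩

theorem zeros [Finite σ] (p : MvPolynomial σ K) :
    IsConstructiblePointSet {x : σ → K | aeval x p = 0} := by
  refine ⟨PrimeSpectrum.zeroLocus {p}, ?_, ?_⟩
  · rw [← isConstructible_compl]
    have hopen := (PrimeSpectrum.isClosed_zeroLocus (R := MvPolynomial σ K) {p}).isOpen_compl
    exact (TopologicalSpace.NoetherianSpace.isCompact _).isConstructible hopen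
  · ext x
    rw [Set.mem_preimage, PrimeSpectrum.mem_zeroLocus, Set.singleton_subset_iff, SetLike.mem_coe,
      mem_asIdeal_pointToPoint, Set.mem_ofPred_eq]

theorem image_comp [IsAlgClosed K] [Finite σ] [Finite τ] {s : Set (τ → K)}
    (hs : IsConstructiblePointSet s) (f : σ → τ) :
    IsConstructiblePointSet ((fun y : τ → K => y ∘ f) '' s) := by
  obtain ⟨C, hC, rfl⟩ := hs
  have hfp : (rename f : MvPolynomial σ K →ₐ[K] _).toRingHom.FinitePresentation := by
    refine RingHom.FinitePresentation.of_comp_finiteType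
      (MvPolynomial.C : K →+* MvPolynomial σ K) ?_ ?_
    · have : (rename f : MvPolynomial σ K →ₐ[K] _).toRingHom.comp MvPolynomial.C =
          algebraMap K (MvPolynomial τ K) := by
        ext; simp [algebraMap_eq]
      rw [this, RingHom.finitePresentation_algebraMap]
      infer_instance
    · rw [← algebraMap_eq, RingHom.finiteType_algebraMap]
      infer_instance
  have hcomap (y : τ → K) : PrimeSpectrum.comap (rename f : MvPolynomial σ K →ₐ[K] _).toRingHom
      (pointToPoint (k := K) y) = pointToPoint (k := K) (y ∘ f) := by
    rw [comap_pointToPoint]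
    simp [Function.comp_def]
  refine ⟨_, PrimeSpectrum.isConstructible_comap_image hfp hC, ?_⟩
  ext x
  constructor
  · rintro ⟨P, hPC, hPx⟩
    obtain ⟨Q, hQC, hPQ, hQ⟩ := PrimeSpectrum.exists_le_isMaximal_mem_of_isConstructible hC hPC
    obtain ⟨y, hy⟩ := isMaximal_iff_eq_vanishingIdeal_singleton.1 hQ
    obtain rfl : Q = pointToPoint (k := K) y := PrimeSpectrum.ext hy
    refine ⟨y, hQC, ?_⟩
    have hle : pointToPoint (k := K) x ≤ pointToPoint (k := K) (y ∘ f) := by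
      rw [← hcomap, ← hPx]
      exact Ideal.comap_mono hPQ
    ext i
    have hmem : X i - MvPolynomial.C (x i) ∈ (pointToPoint (k := K) x).asIdeal := by
      simp [mem_asIdeal_pointToPoint]
    simpa [mem_asIdeal_pointToPoint, sub_eq_zero] using hle hmem
  · rintro ⟨y, hy, rfl⟩
    exact ⟨_, hy, hcomap y⟩

end IsConstructiblePointSet

end Constructible

namespace FirstOrder.Ring

open FirstOrder.Language

variable {K : Type*} [Field K] [CompatibleRing K] {σ : Type*}

theorem exists_mvPolynomial_realize_eq {β : Type*} (v : β → MvPolynomial σ K)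
    (t : Language.ring.Term β) :
    ∃ p : MvPolynomial σ K, ∀ x : σ → K, t.realize (fun b => aeval x (v b)) = aeval x p := by
  induction t with
  | var b => exact ⟨v b, fun _ => rfl⟩
  | func f ts ih =>
    choose p hp using ih
    simp only [Term.realize, hp]
    cases f with
    | add => exact ⟨p 0 + p 1, fun x => by simp⟩
    | mul => exact ⟨p 0 * p 1, fun x => by simp⟩
    | neg => exact ⟨-p 0, fun x => by simp⟩
    | zero => exact ⟨0, fun x => by simp⟩
    | one => exact ⟨1, fun x => by simp⟩

theorem isConstructiblePointSet_realize [IsAlgClosed K] [Finite σ] {A : Set K} {m : ℕ}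
    (φ : Language.ring.BoundedFormula (A ⊕ σ) m) :
    IsConstructiblePointSet {x : σ ⊕ Fin m → K |
      φ.Realize (Sum.elim (↑) (x ∘ Sum.inl)) (x ∘ Sum.inr)} := by
  induction φ with
  | falsum => exact .empty
  | @equal m t₁ t₂ =>
    let v : (A ⊕ σ) ⊕ Fin m → MvPolynomial (σ ⊕ Fin m) K :=
      Sum.elim (Sum.elim (fun a => C a) fun i => X (Sum.inl i)) fun j => X (Sum.inr j)
    have hv (x : σ ⊕ Fin m → K) :
        Sum.elim (Sum.elim (↑) (x ∘ Sum.inl)) (x ∘ Sum.inr) = fun b => aeval x (v b) := by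
      ext ((a | i) | j) <;> simp [v]
    obtain ⟨p₁, h₁⟩ := exists_mvPolynomial_realize_eq v t₁
    obtain ⟨p₂, h₂⟩ := exists_mvPolynomial_realize_eq v t₂
    convert! IsConstructiblePointSet.zeros (p₁ - p₂) using 1
    ext x
    simp only [Set.mem_ofPred_eq, BoundedFormula.Realize, hv, h₁, h₂, map_sub, sub_eq_zero]
  | rel R => exact isEmptyElim R
  | imp φ ψ hφ hψ =>
    convert! hφ.compl.union hψ using 1
    ext x
    simp [imp_iff_not_or]
  | @all m φ hφ =>
    convert! (hφ.compl.image_comp (Sum.map id Fin.castSucc)).compl using 1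
    ext x
    simp only [Set.mem_ofPred_eq, BoundedFormula.realize_all, Set.mem_compl_iff, Set.mem_image,
      not_exists, not_and]
    constructor
    · rintro h y hy rfl
      apply hy
      convert! h (y (Sum.inr (Fin.last m))) using 1
      ext j
      refine Fin.lastCases ?_ (fun j => ?_) j <;> simp
    · intro h a
      by_contra ha
      refine h (Sum.elim (x ∘ Sum.inl) (Fin.snoc (x ∘ Sum.inr) a : Fin (m + 1) → K)) ha ?_
      ext (i | j) <;> simp

theorem isConstructiblePointSet_of_definable [IsAlgClosed K] [Finite σ] {A : Set K}
    {s : Set (σ → K)} (hs : A.Definable Language.ring s) : IsConstructiblePointSet s := by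
  obtain ⟨φ, rfl⟩ := Set.definable_iff_exists_formula_sum.1 hs
  convert! (isConstructiblePointSet_realize φ).image_comp Sum.inl using 1
  ext x
  constructor
  · intro hx
    refine ⟨Sum.elim x Fin.elim0, ?_, by simp⟩
    simpa [Formula.Realize, Subsingleton.elim _ (default : Fin 0 → K)] using hx
  · rintro ⟨y, hy, rfl⟩
    simpa [Formula.Realize, Subsingleton.elim _ (default : Fin 0 → K)] using hy

end FirstOrder.Ring

section Torus

variable {K : Type*} [Field K] {σ : Type*} [Fintype σ]

/-- The character `u ↦ ∏ i, u i ^ k i` of the torus. -/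
def torusCharacter (K : Type*) [Field K] (k : σ → ℤ) : (σ → Kˣ) →* Kˣ where
  toFun u := ∏ i, u i ^ k i
  map_one' := by simp
  map_mul' u v := by simp [mul_zpow, Finset.prod_mul_distrib]

theorem torusCharacter_apply (k : σ → ℤ) (u : σ → Kˣ) :
    torusCharacter K k u = ∏ i, u i ^ k i := rfl

theorem torusCharacter_zero_apply (u : σ → Kˣ) : torusCharacter K 0 u = 1 := by
  simp [torusCharacter_apply]

theorem torusCharacter_add_apply (k l : σ → ℤ) (u : σ → Kˣ) :
    torusCharacter K (k + l) u = torusCharacter K k u * torusCharacter K l u := by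
  simp [torusCharacter_apply, zpow_add, Finset.prod_mul_distrib]

theorem torusCharacter_smul_apply (a : ℤ) (k : σ → ℤ) (u : σ → Kˣ) :
    torusCharacter K (a • k) u = torusCharacter K k u ^ a := by
  simp [torusCharacter_apply, zpow_mul', Finset.prod_zpow]

theorem torusCharacter_sub_apply (k l : σ → ℤ) (u : σ → Kˣ) :
    torusCharacter K (k - l) u = torusCharacter K k u / torusCharacter K l u := by
  simp [torusCharacter_apply, zpow_sub, ← div_eq_mul_inv, Finset.prod_div_distrib]

theorem eval_torus_eq_sum (u : σ → Kˣ) (p : MvPolynomial σ K) :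
    aeval (fun i => (u i : K)) p =
      ∑ d ∈ p.support, p.coeff d * (torusCharacter K (fun i => (d i : ℤ)) u : K) := by
  simp [aeval_eq_eval, eval_eq', torusCharacter_apply, Units.coe_prod]

theorem sum_mul_eq_zero_of_factorsThrough_monoidHom {ι M : Type*} [MulOneClass M] {s : Finset ι}
    {c : ι → K} {χ : ι → M →* K} {e : ι → K} (he : e.FactorsThrough χ)
    (h : ∀ g, ∑ i ∈ s, c i * χ i g = 0) : ∑ i ∈ s, c i * e i = 0 := by
  have hF : ∑ i ∈ s, Finsupp.single (χ i) (c i) = 0 := by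
    refine linearIndependent_iff.1 (linearIndependent_monoidHom M K) _ ?_
    ext g
    simpa using h g
  simpa [he.extend_apply] using
    congrArg (Finsupp.linearCombination K (Function.extend χ e 0)) hF

/-- The subgroup cut out by all characters that are trivial on `G`. -/
def Subgroup.characterHull (G : Subgroup (σ → Kˣ)) : Subgroup (σ → Kˣ) :=
  ⨅ k ∈ {k : σ → ℤ | G ≤ (torusCharacter K k).ker}, (torusCharacter K k).ker

theorem Subgroup.mem_characterHull {G : Subgroup (σ → Kˣ)} {u : σ → Kˣ} :
    u ∈ G.characterHull ↔
      ∀ k, G ≤ (torusCharacter K k).ker → torusCharacter K k u = 1 := by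
  simp [characterHull, Subgroup.mem_iInf, MonoidHom.mem_ker]

theorem Subgroup.le_characterHull (G : Subgroup (σ → Kˣ)) : G ≤ G.characterHull :=
  fun _ hu => mem_characterHull.2 fun _ hk => hk hu

theorem aeval_eq_zero_of_mem_characterHull {G : Subgroup (σ → Kˣ)} {u : σ → Kˣ}
    (hu : u ∈ G.characterHull) {p : MvPolynomial σ K}
    (hp : ∀ g ∈ G, aeval (fun i => (g i : K)) p = 0) : aeval (fun i => (u i : K)) p = 0 := by
  rw [eval_torus_eq_sum]
  let χ (d : σ →₀ ℕ) : G →* K :=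
    (Units.coeHom K).comp ((torusCharacter K fun i => (d i : ℤ)).comp G.subtype)
  refine sum_mul_eq_zero_of_factorsThrough_monoidHom (χ := χ) (fun d d' h => ?_) fun g => ?_
  · have hk : G ≤ (torusCharacter K ((fun i => (d i : ℤ)) - fun i => (d' i : ℤ))).ker := by
      intro g hg
      have := Units.ext (DFunLike.congr_fun h ⟨g, hg⟩)
      rw [MonoidHom.mem_ker, torusCharacter_sub_apply, div_eq_one]
      exact this
    have := Subgroup.mem_characterHull.1 hu _ hk
    rw [torusCharacter_sub_apply, div_eq_one] at this
    exact congrArg _ this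
  · exact (eval_torus_eq_sum _ p).symm.trans (hp g g.2)

theorem Subgroup.eq_characterHull_of_isConstructiblePointSet {G : Subgroup (σ → Kˣ)}
    (hG : IsConstructiblePointSet {x : σ → K | ∃ u ∈ G, ∀ i, (u i : K) = x i}) :
    G = G.characterHull := by
  refine le_antisymm G.le_characterHull (Subgroup.subgroupOf_eq_top.1 ?_)
  obtain ⟨C, hC, hCG⟩ := hG
  let f (u : G.characterHull) : PrimeSpectrum (MvPolynomial σ K) :=
    pointToPoint (k := K) fun i => ((u : σ → Kˣ) i : K)
  have hpre : f ⁻¹' C = (G.subgroupOf G.characterHull : Set G.characterHull) := by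
    ext u
    have := Set.ext_iff.1 hCG fun i => ((u : σ → Kˣ) i : K)
    refine this.trans ⟨?_, fun hu => ⟨u, hu, fun _ => rfl⟩⟩
    rintro ⟨v, hv, hvu⟩
    obtain rfl : v = u := funext fun i => Units.ext (hvu i)
    exact hv
  let : TopologicalSpace G.characterHull := .induced f inferInstance
  refine eq_top_of_dense_of_interior_frontier_eq_empty (fun h => ?_) (fun u => ?_) ?_
  · let φ : MvPolynomial σ K →ₐ[K] MvPolynomial σ K :=
      aeval fun i => MvPolynomial.C ((h : σ → Kˣ) i : K) * X i
    have hφ : f ∘ (h * ·) = PrimeSpectrum.comap φ.toRingHom ∘ f := by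
      ext1 u
      simp only [f, Function.comp_apply, comap_pointToPoint]
      simp [φ]
    rw [continuous_induced_rng, hφ]
    exact (PrimeSpectrum.continuous_comap _).comp continuous_induced_dom
  · rw [closure_induced, ← PrimeSpectrum.zeroLocus_vanishingIdeal_eq_closure,
      PrimeSpectrum.mem_zeroLocus]
    intro p hp
    refine mem_asIdeal_pointToPoint.2 (aeval_eq_zero_of_mem_characterHull u.2 fun g hg => ?_)
    exact mem_asIdeal_pointToPoint.1 ((PrimeSpectrum.mem_vanishingIdeal _ _).1 hp _
      ⟨⟨g, G.le_characterHull hg⟩, hg, rfl⟩)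
  · rw [← hpre]
    exact hC.interior_frontier_preimage continuous_induced_dom

theorem Subgroup.exists_finset_mem_characterHull_iff (G : Subgroup (σ → Kˣ)) :
    ∃ s : Finset (σ → ℤ), ∀ u, u ∈ G.characterHull ↔ ∀ k ∈ s, torusCharacter K k u = 1 := by
  obtain ⟨s, hs, hspan⟩ := Submodule.fg_span_iff_fg_span_finset_subset
    {k : σ → ℤ | G ≤ (torusCharacter K k).ker} |>.1 (IsNoetherian.noetherian (R := ℤ) _)
  refine ⟨s, fun u => mem_characterHull.trans ⟨fun h k hk => h k (hs hk), fun h k hk => ?_⟩⟩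
  replace hk : k ∈ Submodule.span ℤ (s : Set (σ → ℤ)) := hspan ▸ Submodule.subset_span hk
  induction hk using Submodule.span_induction with
  | mem k hk => exact h k hk
  | zero => exact torusCharacter_zero_apply u
  | add k l _ _ hk hl => rw [torusCharacter_add_apply, hk, hl, mul_one]
  | smul a k _ hk => rw [torusCharacter_smul_apply, hk, one_zpow]

end Torus

/-- Every subgroup of `(K^×)ⁿ` which is definable (with parameters) in the language of rings
is defined by finitely many equations of the form `x₁^{k₁}⋯xₙ^{kₙ} = 1` with `kᵢ ∈ ℤ`. -/
theorem definable_subgroup_of_torus (K : Type*) [Field K] [IsAlgClosed K]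
    (n : ℕ) (G : Subgroup (Fin n → Kˣ))
    (hdef :
      letI := Ring.compatibleRingOfRing K
      Set.Definable (Set.univ : Set K) Language.ring
        {x : Fin n → K | ∃ u ∈ G, ∀ i, ((u : Fin n → Kˣ) i : K) = x i}) :
    ∃ s : Finset (Fin n → ℤ),
      ∀ u : Fin n → Kˣ, u ∈ G ↔ ∀ k ∈ s, (∏ i, u i ^ k i) = 1 := by
  let _ := Ring.compatibleRingOfRing K
  have hG := G.eq_characterHull_of_isConstructiblePointSet
    (Ring.isConstructiblePointSet_of_definable hdef)
  obtain ⟨s, hs⟩ := G.exists_finset_mem_characterHull_iff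
  exact ⟨s, fun u => hG ▸ hs u⟩
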